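/- arXiv:2207.10375 — 3 statements merged into one kernel-verified Lean document; each statement's English description precedes it below -/
import Mathlib

section
/- Let p be an odd prime, ψ a nontrivial additive character of F_p with values in ℂ, and φ the quadratic character of F_p. For every λ ∈ F_p with λ ≠ 0 and λ ≠ -1, one has the identity ∑_{χ} g(φχ⁻²) · g(χ)² · χ⁻¹(λ/(1+λ)²) = (p-1) · φ(-1) · φ(1+λ) · g(φ) · ∑_{u∈F_p} φ(u(u-1)(u-λ)), where the sum on the left runs over all multiplicative characters χ of F_p^×. -/
open Finset

/-- A Gauss sum against the additive character rescaled by `c`, where `c = 0` is allowed because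
the multiplicative character is nontrivial. -/
lemma sum_mulChar_mul_addChar_mul {F : Type*} [Field F] [Fintype F] {φ : MulChar F ℂ}
    (hφ : φ ≠ 1) (ψ : AddChar F ℂ) (c : F) :
    ∑ z, φ z * ψ (z * c) = φ⁻¹ c * gaussSum φ ψ := by
  by_cases hc : c = 0
  · simp [hc, MulChar.map_zero, MulChar.sum_eq_zero_of_ne_one hφ]
  · rw [← Units.val_mk0 hc, ← gaussSum_mulShift_eq]
    simp [gaussSum, AddChar.mulShift_apply, mul_comm]

lemma gaussSum_eq_mul_sum {F : Type*} [Field F] [Fintype F] (χ : MulChar F ℂ)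
    (ψ : AddChar F ℂ) {z : F} (hz : z ≠ 0) :
    gaussSum χ ψ = χ z * ∑ s, χ s * ψ (z * s) := by
  rw [← gaussSum_mulShift χ ψ (Units.mk0 z hz)]
  simp [gaussSum, AddChar.mulShift_apply]

/-- The product of Gauss sums as a triple sum, in coordinates relative to the first variable. -/
lemma gaussSum_mul_gaussSum_sq_mul {F : Type*} [Field F] [Fintype F] (φ χ : MulChar F ℂ)
    (ψ : AddChar F ℂ) (a : F) :
    gaussSum (φ * χ⁻¹ ^ 2) ψ * gaussSum χ ψ ^ 2 * χ⁻¹ a =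
      ∑ z, ∑ s, ∑ t, φ z * ψ (z * (1 + s + t)) * χ (s * t * a⁻¹) := by
  rw [gaussSum, sum_mul, sum_mul]
  refine sum_congr rfl fun z _ => ?_
  by_cases hz : z = 0
  · simp [hz, MulChar.map_zero]
  have hχz : χ z ≠ 0 := MulChar.apply_ne_zero_iff.mpr (isUnit_iff_ne_zero.mpr hz)
  rw [gaussSum_eq_mul_sum χ ψ hz, mul_pow, sq (∑ s, _), sum_mul_sum, MulChar.mul_apply,
    MulChar.pow_apply' _ two_ne_zero, MulChar.inv_apply_eq_inv', MulChar.inv_apply']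
  simp only [mul_sum, sum_mul]
  refine sum_congr rfl fun s _ => sum_congr rfl fun t _ => ?_
  rw [mul_add, mul_add, mul_one, AddChar.map_add_eq_mul, AddChar.map_add_eq_mul, map_mul χ,
    map_mul χ]
  field_simp

/-- Summing over all characters `χ` leaves a character sum over the curve `s * t = a`. -/
lemma sum_gaussSum_mul_gaussSum_sq_mul (p : ℕ) [Fact p.Prime] [Fintype (MulChar (ZMod p) ℂ)]
    {φ : MulChar (ZMod p) ℂ} (hφ : φ ≠ 1) (ψ : AddChar (ZMod p) ℂ) {a : ZMod p} (ha : a ≠ 0) :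
    ∑ χ : MulChar (ZMod p) ℂ,
        gaussSum (φ * χ⁻¹ ^ 2) ψ * gaussSum χ ψ ^ 2 * χ⁻¹ a =
      ((p : ℂ) - 1) * gaussSum φ ψ * ∑ s ∈ univ.erase 0, φ⁻¹ (1 + s + a / s) := by
  have orthogonality (b : ZMod p) :
      ∑ χ : MulChar (ZMod p) ℂ, χ b = if b = 1 then (p : ℂ) - 1 else 0 := by
    rw [← Nat.cast_pred (Fact.out : p.Prime).pos, ← Nat.totient_prime Fact.out]
    convert DirichletCharacter.sum_characters_eq ℂ b
  calc
    _ = ∑ s, ∑ t, ∑ z, φ z * ψ (z * (1 + s + t)) *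
          if s * t * a⁻¹ = 1 then (p : ℂ) - 1 else 0 := by
      simp_rw [gaussSum_mul_gaussSum_sq_mul, ← orthogonality, mul_sum]
      rw [sum_comm_cycle]
      refine sum_congr rfl fun s _ => ?_
      refine sum_comm_cycle.trans (sum_congr rfl fun t _ => ?_)
      exact sum_comm
    _ = ∑ s, if s = 0 then 0 else ((p : ℂ) - 1) * gaussSum φ ψ * φ⁻¹ (1 + s + a / s) := by
      refine sum_congr rfl fun s _ => ?_
      simp_rw [← sum_mul, sum_mulChar_mul_addChar_mul hφ]
      split_ifs with hs
      · simp [hs]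
      have key (t : ZMod p) : s * t * a⁻¹ = 1 ↔ t = a / s := by
        field_simp
      simp only [key, mul_ite, mul_zero, sum_ite_eq', mem_univ, if_true]
      ring
    _ = _ := by
      rw [← sum_erase univ (a := (0 : ZMod p)) (by simp), mul_sum]
      exact sum_congr rfl fun s hs => if_neg (ne_of_mem_erase hs)

/-- **A Gauss sum identity for the `₂G₂` function.**
Let `p` be an odd prime, `ψ` a nontrivial additive character of `F_p` with values
in `ℂ`, and `φ` the quadratic character of `F_p` (viewed with values in `ℂ`). For
`λ ∈ F_p` with `λ ≠ 0`, `λ ≠ -1`, one has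
`∑_χ g(φχ⁻²)·g(χ)²·χ⁻¹(λ/(1+λ)²) = (p-1)·φ(-1)·φ(1+λ)·g(φ)·∑_u φ(u(u-1)(u-λ))`,
where the sum runs over all multiplicative characters `χ` of `F_p`. -/
theorem gaussSum_identity_2G2 (p : ℕ) [Fact p.Prime] (hp : Odd p)
    (ψ : AddChar (ZMod p) ℂ) (hψ : ψ ≠ 1) (l : ZMod p) (hl0 : l ≠ 0) (hl1 : l ≠ -1) :
    letI : Fintype (MulChar (ZMod p) ℂ) := Fintype.ofFinite _
    let φ : MulChar (ZMod p) ℂ := (quadraticChar (ZMod p)).ringHomComp (Int.castRingHom ℂ)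
    ∑ χ : MulChar (ZMod p) ℂ,
        gaussSum (φ * χ⁻¹ ^ 2) ψ * (gaussSum χ ψ) ^ 2 * χ⁻¹ (l / (1 + l) ^ 2) =
      ((p : ℂ) - 1) * φ (-1) * φ (1 + l) * gaussSum φ ψ *
        ∑ u : ZMod p, φ (u * (u - 1) * (u - l)) := by
  intro φ
  have hp2 : ringChar (ZMod p) ≠ 2 := by
    rw [ZMod.ringChar_zmod_n]
    rintro rfl
    exact absurd hp (by decide)
  have hφ : φ ≠ 1 :=
    (MulChar.ringHomComp_ne_one_iff Int.cast_injective).mpr (quadraticChar_ne_one hp2)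
  have hφq : φ.IsQuadratic := (quadraticChar_isQuadratic (ZMod p)).comp _
  have hsq {x : ZMod p} (hx : x ≠ 0) : φ x * φ x = 1 := by
    rw [← sq, ← MulChar.pow_apply' _ two_ne_zero, hφq.sq_eq_one,
      MulChar.one_apply (isUnit_iff_ne_zero.mpr hx)]
  have hl : 1 + l ≠ 0 := fun h => hl1 (eq_neg_of_add_eq_zero_right h)
  have hc : -(1 + l)⁻¹ ≠ 0 := neg_ne_zero.mpr (inv_ne_zero hl)
  rw [sum_gaussSum_mul_gaussSum_sq_mul p hφ ψ (div_ne_zero hl0 (pow_ne_zero 2 hl)), hφq.inv]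
  have hsum : ∑ s ∈ univ.erase 0, φ (1 + s + l / (1 + l) ^ 2 / s) =
      φ (-1) * φ (1 + l) * ∑ u : ZMod p, φ (u * (u - 1) * (u - l)) := by
    calc
      _ = ∑ s ∈ univ.erase 0, φ (s * (s ^ 2 + s + l / (1 + l) ^ 2)) := by
        refine sum_congr rfl fun s hs => ?_
        have hs0 := ne_of_mem_erase hs
        rw [show s * (s ^ 2 + s + l / (1 + l) ^ 2) = s * s * (1 + s + l / (1 + l) ^ 2 / s) by
          field_simp; ring, map_mul φ (s * s), map_mul φ s s, hsq hs0, one_mul]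
      _ = ∑ s, φ (s * (s ^ 2 + s + l / (1 + l) ^ 2)) :=
        sum_erase _ (by simp [MulChar.map_zero])
      _ = _ := by
        rw [mul_sum, ← Equiv.sum_comp (Equiv.mulLeft₀ _ hc)]
        refine sum_congr rfl fun u _ => ?_
        rw [Equiv.mulLeft₀_apply, ← map_mul, ← map_mul]
        have hinv : (1 + l)⁻¹ ^ 2 ≠ 0 := pow_ne_zero 2 (inv_ne_zero hl)
        rw [← one_mul (φ (-1 * _ * _)), ← hsq hinv, ← map_mul, ← map_mul]
        congr 1
        field_simp
        ring
  rw [hsum]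
  ring
end

section
/- Let p be an odd prime with p ≡ 2 (mod 3), ψ a nontrivial additive character of F_p with values in ℂ, and φ the quadratic character of F_p. For every λ ∈ F_p with λ ≠ 0 and λ ≠ -1, one has the identity ∑_{χ} g(φχ⁶) · g(χ⁻³)² · χ(λ³/(1+λ)⁶) = (p-1) · φ(-1) · φ(1+λ) · g(φ) · ∑_{u∈F_p} φ(u(u-1)(u-λ)), where the sum on the left runs over all multiplicative characters χ of F_p^×. -/
open Finset

section CharacterSums

variable {p : ℕ} [Fact p.Prime]

/-- Shifting the argument of the additive character in a quadratic Gauss sum. -/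
lemma sum_quadratic_mul_addChar_mul {φ : MulChar (ZMod p) ℂ} (hφ : φ.IsQuadratic) (hφ1 : φ ≠ 1)
    (ψ : AddChar (ZMod p) ℂ) (c : ZMod p) :
    ∑ x, φ x * ψ (x * c) = φ c * gaussSum φ ψ := by
  by_cases hc : c = 0
  · simp [hc, MulChar.map_zero, MulChar.sum_eq_zero_of_ne_one hφ1]
  · have h := gaussSum_mulShift φ ψ (Units.mk0 c hc)
    have hsq : φ c * φ c = 1 := by
      rw [← MulChar.mul_apply, ← sq, hφ.sq_eq_one, MulChar.one_apply (isUnit_iff_ne_zero.mpr hc)]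
    rw [← h, Units.val_mk0, ← mul_assoc, hsq, one_mul]
    simp [gaussSum, AddChar.mulShift_apply, mul_comm]

/-- Orthogonality of multiplicative characters, valid at every pair of arguments. -/
lemma sum_mulChar_inv_mul [Fintype (MulChar (ZMod p) ℂ)] (a b : ZMod p) :
    ∑ χ : MulChar (ZMod p) ℂ, χ a⁻¹ * χ b = if a ≠ 0 ∧ a = b then (p : ℂ) - 1 else 0 := by
  by_cases ha : a = 0
  · simp [ha, MulChar.map_zero]
  · have h := DirichletCharacter.sum_char_inv_mul_char_eq ℂ (isUnit_iff_ne_zero.mpr ha) b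
    rw [Nat.totient_prime Fact.out, Nat.cast_sub (Fact.out : p.Prime).one_le, Nat.cast_one] at h
    simp only [ne_eq, ha, not_false_eq_true, true_and]
    convert h

/-- Rescaling both summation variables by `x ≠ 0` in a sum over the hyperbola `y z = x² t`. -/
lemma sum_hyperbola {x t : ZMod p} (hx : x ≠ 0) (ht : t ≠ 0) (f : ZMod p → ℂ) :
    ∑ y, ∑ z, (if y * z ≠ 0 ∧ y * z = x ^ 2 * t then f (x + y + z) else 0) =
      ∑ a, if a ≠ 0 then f (x * (1 + a + t / a)) else 0 := by
  rw [← Equiv.sum_comp (Equiv.mulLeft₀ x hx)]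
  refine sum_congr rfl fun a _ => ?_
  rw [← Equiv.sum_comp (Equiv.mulLeft₀ x hx)]
  simp only [Equiv.mulLeft₀_apply]
  split_ifs with ha
  · rw [sum_eq_single (t / a)]
    · rw [if_pos]
      · congr 1; ring
      · constructor
        · simp [hx, ht, ha]
        · field_simp
    · intro b _ hb
      refine if_neg fun h => hb ?_
      rw [eq_div_iff ha]
      refine mul_left_cancel₀ (pow_ne_zero 2 hx) ?_
      linear_combination h.2
    · simp
  · have ha : a = 0 := by simpa using ha
    simp [ha]

/-- The Mellin-type sum of Gauss sums, evaluated as a sum of quadratic character values. -/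
lemma sum_gaussSum_mul_gaussSum_inv_sq [Fintype (MulChar (ZMod p) ℂ)] {φ : MulChar (ZMod p) ℂ}
    (hφ : φ.IsQuadratic) (hφ1 : φ ≠ 1) (ψ : AddChar (ZMod p) ℂ) {t : ZMod p} (ht : t ≠ 0) :
    ∑ χ : MulChar (ZMod p) ℂ, gaussSum (φ * χ ^ 2) ψ * gaussSum χ⁻¹ ψ ^ 2 * χ t =
      ((p : ℂ) - 1) * gaussSum φ ψ * ∑ a, φ (a * (a ^ 2 + a + t)) := by
  have expand (χ : MulChar (ZMod p) ℂ) :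
      gaussSum (φ * χ ^ 2) ψ * gaussSum χ⁻¹ ψ ^ 2 * χ t =
        ∑ x, ∑ y, ∑ z, φ x * ψ (x + y + z) * (χ (y * z)⁻¹ * χ (x ^ 2 * t)) := by
    rw [sq (gaussSum χ⁻¹ ψ), gaussSum, gaussSum, sum_mul_sum, sum_mul_sum, sum_mul]
    refine sum_congr rfl fun x _ => ?_
    rw [sum_mul]
    refine sum_congr rfl fun y _ => ?_
    rw [mul_sum, sum_mul]
    refine sum_congr rfl fun z _ => ?_
    simp only [MulChar.mul_apply, MulChar.pow_apply' _ two_ne_zero, MulChar.inv_apply',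
      mul_inv, map_mul, map_pow, AddChar.map_add_eq_mul]
    ring
  have inner (x : ZMod p) :
      ∑ y, ∑ z, φ x * ψ (x + y + z) *
          (if y * z ≠ 0 ∧ y * z = x ^ 2 * t then (p : ℂ) - 1 else 0) =
        ∑ a, if a ≠ 0 then ((p : ℂ) - 1) * (φ x * ψ (x * (1 + a + t / a))) else 0 := by
    by_cases hx : x = 0
    · simp [hx, MulChar.map_zero]
    · have h := sum_hyperbola hx ht fun s => ((p : ℂ) - 1) * (φ x * ψ s)
      rw [← h]
      refine sum_congr rfl fun y _ => sum_congr rfl fun z _ => ?_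
      split_ifs <;> ring
  calc _ = ∑ x, ∑ y, ∑ z, φ x * ψ (x + y + z) *
          (if y * z ≠ 0 ∧ y * z = x ^ 2 * t then (p : ℂ) - 1 else 0) := by
        simp only [expand]
        rw [sum_comm]
        refine sum_congr rfl fun x _ => ?_
        rw [sum_comm]
        refine sum_congr rfl fun y _ => ?_
        rw [sum_comm]
        refine sum_congr rfl fun z _ => ?_
        rw [← mul_sum, sum_mulChar_inv_mul]
    _ = ((p : ℂ) - 1) * gaussSum φ ψ * ∑ a, φ (a * (a ^ 2 + a + t)) := by
        simp only [inner]
        rw [sum_comm, mul_sum]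
        refine sum_congr rfl fun a _ => ?_
        by_cases ha : a = 0
        · simp [ha, MulChar.map_zero]
        · simp only [ne_eq, ha, not_false_eq_true, if_true]
          have hsq : φ (a ^ 2) = 1 := by
            rw [map_pow, ← MulChar.pow_apply' _ two_ne_zero, hφ.sq_eq_one,
              MulChar.one_apply (isUnit_iff_ne_zero.mpr ha)]
          have harg : a * (a ^ 2 + a + t) = a ^ 2 * (1 + a + t / a) := by
            field_simp
            ring
          rw [← mul_sum, sum_quadratic_mul_addChar_mul hφ hφ1, harg, map_mul, hsq]
          ring

/-- The cubic `a (a² + a + l / (1 + l)²)` is a twist of the Legendre cubic. -/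
lemma sum_cubic_eq_legendre {φ : MulChar (ZMod p) ℂ} (hφ : φ.IsQuadratic) {l : ZMod p}
    (hl : 1 + l ≠ 0) :
    ∑ a, φ (a * (a ^ 2 + a + l / (1 + l) ^ 2)) =
      φ (-1) * φ (1 + l) * ∑ u, φ (u * (u - 1) * (u - l)) := by
  have hc : -(1 + l)⁻¹ ≠ 0 := neg_ne_zero.mpr (inv_ne_zero hl)
  rw [← Equiv.sum_comp (Equiv.mulLeft₀ _ hc), mul_sum]
  refine sum_congr rfl fun u _ => ?_
  have harg : -(1 + l)⁻¹ * u * ((-(1 + l)⁻¹ * u) ^ 2 + -(1 + l)⁻¹ * u + l / (1 + l) ^ 2) =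
      ((1 + l)⁻¹ ^ 2) ^ 2 * (-1 * (1 + l) * (u * (u - 1) * (u - l))) := by
    field_simp
    ring
  have hsq : φ (((1 + l)⁻¹ ^ 2) ^ 2) = 1 := by
    rw [map_pow, ← MulChar.pow_apply' _ two_ne_zero, hφ.sq_eq_one,
      MulChar.one_apply (isUnit_iff_ne_zero.mpr (pow_ne_zero 2 (inv_ne_zero hl)))]
  rw [Equiv.mulLeft₀_apply, harg, map_mul, hsq, map_mul, map_mul, one_mul]

/-- Cubing permutes the multiplicative characters of `F_p` when `p ≡ 2 (mod 3)`. -/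
lemma mulChar_cube_bijective (hp3 : p % 3 = 2) :
    Function.Bijective fun χ : MulChar (ZMod p) ℂ => χ ^ 3 := by
  refine Finite.injective_iff_bijective.mp fun χ χ' h => ?_
  have hcop : (Nat.card (MulChar (ZMod p) ℂ)).Coprime 3 := by
    rw [MulChar.card_eq_card_units_of_hasEnoughRootsOfUnity, Nat.card_eq_fintype_card,
      ZMod.card_units, Nat.coprime_comm, Nat.Prime.coprime_iff_not_dvd Nat.prime_three]
    omega
  exact (powCoprime hcop).injective h

end CharacterSums


/-- **A Gauss sum identity for the `₆G₆` function.**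
Let `p ≡ 2 (mod 3)` be an odd prime, `ψ` a nontrivial additive character of `F_p`
with values in `ℂ`, and `φ` the quadratic character of `F_p` (viewed with values
in `ℂ`). For `λ ∈ F_p` with `λ ≠ 0`, `λ ≠ -1`, one has
`∑_χ g(φχ⁶)·g(χ⁻³)²·χ(λ³/(1+λ)⁶) = (p-1)·φ(-1)·φ(1+λ)·g(φ)·∑_u φ(u(u-1)(u-λ))`,
where the sum runs over all multiplicative characters `χ` of `F_p`. -/
theorem gaussSum_identity_6G6 (p : ℕ) [Fact p.Prime] (hp : Odd p) (hp3 : p % 3 = 2)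
    (ψ : AddChar (ZMod p) ℂ) (hψ : ψ ≠ 1) (l : ZMod p) (hl0 : l ≠ 0) (hl1 : l ≠ -1) :
    letI : Fintype (MulChar (ZMod p) ℂ) := Fintype.ofFinite _
    let φ : MulChar (ZMod p) ℂ := (quadraticChar (ZMod p)).ringHomComp (Int.castRingHom ℂ)
    ∑ χ : MulChar (ZMod p) ℂ,
        gaussSum (φ * χ ^ 6) ψ * (gaussSum (χ⁻¹ ^ 3) ψ) ^ 2 * χ (l ^ 3 / (1 + l) ^ 6) =
      ((p : ℂ) - 1) * φ (-1) * φ (1 + l) * gaussSum φ ψ *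
        ∑ u : ZMod p, φ (u * (u - 1) * (u - l)) := by
  let : Fintype (MulChar (ZMod p) ℂ) := Fintype.ofFinite _
  intro φ
  have hφ : φ.IsQuadratic := (quadraticChar_isQuadratic (ZMod p)).comp _
  have hp2 : ringChar (ZMod p) ≠ 2 := by
    rw [ZMod.ringChar_zmod_n]
    rintro rfl
    exact absurd hp (by decide)
  have hφ1 : φ ≠ 1 :=
    (MulChar.ringHomComp_ne_one_iff Int.cast_injective).mpr (quadraticChar_ne_one hp2)
  have hl : 1 + l ≠ 0 := fun h => hl1 (by linear_combination h)
  have ht : l / (1 + l) ^ 2 ≠ 0 := div_ne_zero hl0 (pow_ne_zero 2 hl)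
  have hcube := (mulChar_cube_bijective hp3).sum_comp fun χ : MulChar (ZMod p) ℂ =>
    gaussSum (φ * χ ^ 2) ψ * gaussSum χ⁻¹ ψ ^ 2 * χ (l / (1 + l) ^ 2)
  have hterm (χ : MulChar (ZMod p) ℂ) :
      gaussSum (φ * χ ^ 6) ψ * (gaussSum (χ⁻¹ ^ 3) ψ) ^ 2 * χ (l ^ 3 / (1 + l) ^ 6) =
        gaussSum (φ * (χ ^ 3) ^ 2) ψ * gaussSum (χ ^ 3)⁻¹ ψ ^ 2 * (χ ^ 3) (l / (1 + l) ^ 2) := by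
    rw [MulChar.pow_apply' _ three_ne_zero, ← map_pow, div_pow, ← pow_mul, ← pow_mul, inv_pow]
  rw [sum_congr rfl fun χ _ => hterm χ, hcube, sum_gaussSum_mul_gaussSum_inv_sq hφ hφ1 ψ ht,
    sum_cubic_eq_legendre hφ hl]
  ring
end

section
/- (Davenport–Hasse relation) Let n be a positive integer, p a prime with p ≡ 1 (mod n) and p ∤ n, and ψ a fixed nontrivial additive character of F_p with values in ℂ. Then for every multiplicative character κ of F_p^×, ∏_{χ : χⁿ = ε} g(χκ) = -g(κⁿ) · κ(n^{-n}) · ∏_{χ : χⁿ = ε} g(χ), where both products run over all multiplicative characters χ of F_p^× satisfying χⁿ = ε (ε the trivial character). -/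
open Finset
open scoped Classical

open Polynomial

/-- The monic polynomials of degree `k` over a finite field. -/
noncomputable def monicsOfDegree (F : Type*) [Field F] [Fintype F] (k : ℕ) : Finset F[X] :=
  Finset.univ.image fun a : Fin k → F => X ^ k + ∑ i : Fin k, C (a i) * X ^ (i : ℕ)

theorem mem_monicsOfDegree {F : Type*} [Field F] [Fintype F] {k : ℕ} {f : F[X]} :
    f ∈ monicsOfDegree F k ↔ f.Monic ∧ f.natDegree = k := by
  simp only [monicsOfDegree, Finset.mem_image, Finset.mem_univ, true_and]
  constructor
  · rintro ⟨a, rfl⟩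
    have h : (∑ i : Fin k, C (a i) * X ^ (i : ℕ) : F[X]).degree < k := by
      refine (degree_sum_le _ _).trans_lt ?_
      refine (Finset.sup_lt_iff (WithBot.bot_lt_coe k)).2 fun i _ => ?_
      exact (degree_C_mul_X_pow_le _ _).trans_lt (WithBot.coe_lt_coe.2 i.2)
    exact ⟨monic_X_pow_add h, natDegree_eq_of_degree_eq_some (by
      rw [degree_add_eq_left_of_degree_lt] <;> simp [h])⟩
  · rintro ⟨hf, rfl⟩
    refine ⟨fun i => f.coeff i, ?_⟩
    conv_rhs => rw [hf.as_sum]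
    rw [← Fin.sum_univ_eq_sum_range (fun i => C (f.coeff i) * X ^ i)]

/-- The characteristic polynomial of an element `x` of a finite extension `K / F`, as a power of
its minimal polynomial. -/
noncomputable def minpolyPow (F : Type*) {K : Type*} [Field F] [Field K] [Algebra F K] (x : K) :
    F[X] :=
  minpoly F x ^ (Module.finrank F K / (minpoly F x).natDegree)

section MinpolyPow

variable {F K : Type*} [Field F] [Field K] [Algebra F K] [FiniteDimensional F K]

theorem minpolyPow_monic (x : K) : (minpolyPow F x).Monic :=
  (minpoly.monic (IsIntegral.of_finite F x)).pow _

theorem natDegree_minpolyPow (x : K) : (minpolyPow F x).natDegree = Module.finrank F K := by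
  rw [minpolyPow, natDegree_pow]
  exact Nat.div_mul_cancel (minpoly.degree_dvd (IsIntegral.of_finite F x))

theorem finrank_div_natDegree_minpoly_pos (x : K) :
    0 < Module.finrank F K / (minpoly F x).natDegree :=
  Nat.div_pos (Nat.le_of_dvd Module.finrank_pos
    (minpoly.degree_dvd (IsIntegral.of_finite F x))) (minpoly.natDegree_pos (.of_finite F x))

theorem card_filter_minpoly_eq [Finite F] [Fintype K] {P : F[X]} (hP : Irreducible P)
    (hm : P.Monic) (hd : P.natDegree ∣ Module.finrank F K) :
    (Finset.univ.filter fun x : K => minpoly F x = P).card = P.natDegree := by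
  have hs : (P.map (algebraMap F K)).Splits := by
    have h1 := hP.natDegree_dvd_iff_dvd_X_pow_card_pow_sub_X.1 hd
    rw [← Module.natCard_eq_pow_finrank] at h1
    have h2 := Polynomial.map_dvd (algebraMap F K) h1
    refine Splits.of_dvd (Polynomial.splits_X_pow_nat_card_sub_X (K := K)) ?_ ?_
    · exact FiniteField.X_pow_card_sub_X_ne_zero K Finite.one_lt_card
    · simpa using h2
  rw [← card_rootSet_eq_natDegree (PerfectField.separable_of_irreducible hP) hs,
    Fintype.card_of_subtype]
  intro x
  simp only [Finset.mem_filter, Finset.mem_univ, true_and, mem_rootSet, ne_eq, hP.ne_zero,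
    not_false_eq_true]
  constructor
  · rintro rfl
    exact minpoly.aeval F x
  · intro h
    exact (minpoly.eq_of_irreducible_of_monic hP h hm).symm

end MinpolyPow

theorem natDegree_eq_sum_normalizedFactors {F : Type*} [Field F] {f : F[X]} (hf : f.Monic) :
    f.natDegree = ∑ P ∈ (UniqueFactorizationMonoid.normalizedFactors f).toFinset,
      (UniqueFactorizationMonoid.normalizedFactors f).count P * P.natDegree := by
  have h := leadingCoeff_mul_prod_normalizedFactors f
  rw [hf.leadingCoeff, C_1, one_mul] at h
  conv_lhs => rw [← h]
  rw [natDegree_multiset_prod_of_monic, Finset.sum_multiset_map_count]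
  · simp
  · intro P hP
    exact ((Polynomial.mem_normalizedFactors_iff hf.ne_zero).1 hP).2.1

theorem card_filter_pow_dvd {F : Type*} [Field F] {f P : F[X]} (hf : f.Monic)
    (hP : Irreducible P) (hm : P.Monic) :
    ((Finset.Icc 1 f.natDegree).filter
      fun j => P.natDegree ∣ j ∧ P ^ (j / P.natDegree) ∣ f).card =
      (UniqueFactorizationMonoid.normalizedFactors f).count P := by
  have hd := hP.natDegree_pos
  have key (i : ℕ) : P ^ i ∣ f ↔
      i ≤ (UniqueFactorizationMonoid.normalizedFactors f).count P := by
    rw [pow_dvd_iff_le_emultiplicity,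
      UniqueFactorizationMonoid.emultiplicity_eq_count_normalizedFactors hP hf.ne_zero,
      hm.normalize_eq_self, Nat.cast_le]
  symm
  trans (Finset.Icc 1 ((UniqueFactorizationMonoid.normalizedFactors f).count P)).card
  · simp
  refine Finset.card_bij (fun i _ => i * P.natDegree) ?_ ?_ ?_
  · intro i hi
    rw [Finset.mem_Icc] at hi
    rw [Finset.mem_filter, Finset.mem_Icc, Nat.mul_div_cancel _ hd, key]
    refine ⟨⟨Nat.mul_pos hi.1 hd, ?_⟩, Dvd.intro_left _ rfl, hi.2⟩
    rw [← natDegree_pow]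
    exact natDegree_le_of_dvd ((key i).2 hi.2) hf.ne_zero
  · intro a _ b _ h
    exact Nat.eq_of_mul_eq_mul_right hd h
  · intro j hj
    rw [Finset.mem_filter, Finset.mem_Icc, key] at hj
    obtain ⟨⟨h1, _⟩, h3, h4⟩ := hj
    exact ⟨j / P.natDegree, Finset.mem_Icc.2 ⟨Nat.div_pos (Nat.le_of_dvd h1 h3) hd, h4⟩,
      Nat.div_mul_cancel h3⟩

theorem card_filter_minpolyPow_dvd {F K : Type*} [Field F] [Finite F] [Field K] [Algebra F K]
    [FiniteDimensional F K] [Fintype K] {f : F[X]} (hf : f.Monic) :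
    (Finset.univ.filter fun x : K => minpolyPow F x ∣ f).card =
      ∑ P ∈ (UniqueFactorizationMonoid.normalizedFactors f).toFinset,
        if P.natDegree ∣ Module.finrank F K ∧ P ^ (Module.finrank F K / P.natDegree) ∣ f
        then P.natDegree else 0 := by
  rw [Finset.card_eq_sum_card_fiberwise (f := fun x : K => minpoly F x)
    (t := (UniqueFactorizationMonoid.normalizedFactors f).toFinset)]
  · refine Finset.sum_congr rfl fun P hP => ?_
    rw [Multiset.mem_toFinset, Polynomial.mem_normalizedFactors_iff hf.ne_zero] at hP
    rw [Finset.filter_filter]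
    split_ifs with h
    · rw [← card_filter_minpoly_eq (K := K) hP.1 hP.2.1 h.1]
      congr 1
      ext x
      simp only [Finset.mem_filter, Finset.mem_univ, true_and, and_iff_right_iff_imp]
      rintro rfl
      exact h.2
    · rw [Finset.card_eq_zero, Finset.filter_eq_empty_iff]
      rintro x _ ⟨hx, rfl⟩
      exact h ⟨minpoly.degree_dvd (IsIntegral.of_finite F x), hx⟩
  · intro x hx
    have hi := IsIntegral.of_finite F x
    simp only [Finset.coe_filter, Finset.mem_univ, true_and, Set.mem_ofPred_eq] at hx
    simp only [Finset.mem_coe, Multiset.mem_toFinset,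
      Polynomial.mem_normalizedFactors_iff hf.ne_zero]
    exact ⟨minpoly.irreducible hi, minpoly.monic hi,
      (dvd_pow_self _ (finrank_div_natDegree_minpoly_pos x).ne').trans hx⟩

section EulerProduct

variable {F : Type*} [Field F] [Fintype F] (K : ℕ → Type*) [∀ j, Field (K j)]
  [∀ j, Algebra F (K j)] [∀ j, FiniteDimensional F (K j)] [∀ j, Fintype (K j)]

theorem sum_card_minpolyPow_dvd (hK : ∀ j, 1 ≤ j → Module.finrank F (K j) = j)
    {f : F[X]} (hf : f.Monic) :
    ∑ j ∈ Finset.Icc 1 f.natDegree,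
      (Finset.univ.filter fun x : K j => minpolyPow F x ∣ f).card =
      f.natDegree := by
  have h (j : ℕ) (hj : j ∈ Finset.Icc 1 f.natDegree) :
      (Finset.univ.filter fun x : K j => minpolyPow F x ∣ f).card =
      ∑ P ∈ (UniqueFactorizationMonoid.normalizedFactors f).toFinset,
        if P.natDegree ∣ j ∧ P ^ (j / P.natDegree) ∣ f then P.natDegree else 0 := by
    rw [card_filter_minpolyPow_dvd hf, hK j (Finset.mem_Icc.1 hj).1]
  rw [Finset.sum_congr rfl h, Finset.sum_comm, natDegree_eq_sum_normalizedFactors hf]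
  refine Finset.sum_congr rfl fun P hP => ?_
  rw [Multiset.mem_toFinset, Polynomial.mem_normalizedFactors_iff hf.ne_zero] at hP
  rw [← natDegree_eq_sum_normalizedFactors hf, ← Finset.sum_filter, Finset.sum_const,
    card_filter_pow_dvd hf hP.1 hP.2.1, smul_eq_mul]

/-- The logarithmic derivative of the Euler product attached to a multiplicative function on monic
polynomials, coefficientwise. -/
theorem natCast_mul_sum_monicsOfDegree
    (hK : ∀ j, 1 ≤ j → Module.finrank F (K j) = j) (w : F[X] → ℂ)
    (hw : ∀ f g, f.Monic → g.Monic → w (f * g) = w f * w g) (k : ℕ) :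
    (k : ℂ) * ∑ f ∈ monicsOfDegree F k, w f =
      ∑ j ∈ Finset.Icc 1 k, (∑ x : K j, w (minpolyPow F x)) *
        ∑ g ∈ monicsOfDegree F (k - j), w g := by
  have h1 : (k : ℂ) * ∑ f ∈ monicsOfDegree F k, w f =
      ∑ f ∈ monicsOfDegree F k, ∑ j ∈ Finset.Icc 1 k, ∑ x : K j,
        if minpolyPow F x ∣ f then w f else 0 := by
    rw [Finset.mul_sum]
    refine Finset.sum_congr rfl fun f hf => ?_
    obtain ⟨hm, rfl⟩ := mem_monicsOfDegree.1 hf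
    conv_lhs => rw [← sum_card_minpolyPow_dvd K hK hm]
    rw [Nat.cast_sum, Finset.sum_mul]
    refine Finset.sum_congr rfl fun j _ => ?_
    rw [← Finset.sum_filter, Finset.sum_const, nsmul_eq_mul]
  rw [h1, Finset.sum_comm]
  refine Finset.sum_congr rfl fun j hj => ?_
  rw [Finset.sum_comm, Finset.sum_mul]
  refine Finset.sum_congr rfl fun x _ => ?_
  rw [Finset.mem_Icc] at hj
  have hdeg : (minpolyPow F x).natDegree = j := by
    rw [natDegree_minpolyPow, hK j hj.1]
  have hmon := minpolyPow_monic (F := F) x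
  rw [← Finset.sum_filter, Finset.mul_sum]
  symm
  refine Finset.sum_bij (fun g _ => minpolyPow F x * g) ?_ ?_ ?_ ?_
  · intro g hg
    obtain ⟨hg, hgd⟩ := mem_monicsOfDegree.1 hg
    rw [Finset.mem_filter, mem_monicsOfDegree, hmon.natDegree_mul hg]
    exact ⟨⟨hmon.mul hg, by omega⟩, dvd_mul_right _ _⟩
  · intro a _ b _ h
    exact mul_left_cancel₀ hmon.ne_zero h
  · intro f hf
    rw [Finset.mem_filter, mem_monicsOfDegree] at hf
    obtain ⟨⟨hf, hfd⟩, g, rfl⟩ := hf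
    have hg := hmon.of_mul_monic_left hf
    refine ⟨g, mem_monicsOfDegree.2 ⟨hg, ?_⟩, rfl⟩
    rw [hmon.natDegree_mul hg] at hfd
    omega
  · intro g hg
    exact (hw _ _ hmon (mem_monicsOfDegree.1 hg).1).symm

end EulerProduct

/-- The `m`-th power sum of the roots of `f`, read off from the logarithmic derivative of the
reversed polynomial. -/
noncomputable def rootPowerSum {F : Type*} [Field F] (m : ℕ) (f : F[X]) : F :=
  PowerSeries.coeff m
    (-(PowerSeries.X * PowerSeries.derivative F (f.reverse : PowerSeries F) *
      (f.reverse : PowerSeries F)⁻¹))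

section RootPowerSum

variable {F : Type*} [Field F]

theorem constantCoeff_reverse {f : F[X]} (hf : f.Monic) :
    PowerSeries.constantCoeff (f.reverse : PowerSeries F) = 1 := by
  rw [← PowerSeries.coeff_zero_eq_constantCoeff_apply, Polynomial.coeff_coe,
    coeff_zero_reverse, hf.leadingCoeff]

theorem rootPowerSum_mul (m : ℕ) {f g : F[X]} (hf : f.Monic) (hg : g.Monic) :
    rootPowerSum m (f * g) = rootPowerSum m f + rootPowerSum m g := by
  simp only [rootPowerSum, reverse_mul_of_domain, Polynomial.coe_mul, ← map_add]
  congr 1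
  have h1 := PowerSeries.mul_inv_cancel (f.reverse : PowerSeries F)
    (by simp [constantCoeff_reverse hf])
  have h2 := PowerSeries.mul_inv_cancel (g.reverse : PowerSeries F)
    (by simp [constantCoeff_reverse hg])
  rw [PowerSeries.mul_inv_rev, Derivation.leibniz, smul_eq_mul, smul_eq_mul]
  linear_combination
    (-PowerSeries.X * PowerSeries.derivative F (g.reverse : PowerSeries F) *
      (g.reverse : PowerSeries F)⁻¹) * h1 -
    PowerSeries.X * PowerSeries.derivative F (f.reverse : PowerSeries F) *
      (f.reverse : PowerSeries F)⁻¹ * h2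

theorem rootPowerSum_one (m : ℕ) : rootPowerSum m (1 : F[X]) = 0 := by
  have := rootPowerSum_mul m (monic_one (R := F)) monic_one
  simpa using this

theorem rootPowerSum_pow (m : ℕ) {f : F[X]} (hf : f.Monic) (k : ℕ) :
    rootPowerSum m (f ^ k) = k * rootPowerSum m f := by
  induction k with
  | zero => simp [rootPowerSum_one]
  | succ k ih => rw [pow_succ, rootPowerSum_mul m (hf.pow k) hf, ih]; push_cast; ring

theorem rootPowerSum_multiset_prod (m : ℕ) (s : Multiset F[X]) (hs : ∀ f ∈ s, f.Monic) :
    rootPowerSum m s.prod = (s.map (rootPowerSum m)).sum := by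
  induction s using Multiset.induction_on with
  | empty => simp [rootPowerSum_one]
  | cons f s ih =>
    have hs' : ∀ g ∈ s, g.Monic := fun g hg => hs g (Multiset.mem_cons_of_mem hg)
    rw [Multiset.prod_cons, Multiset.map_cons, Multiset.sum_cons,
      rootPowerSum_mul m (hs f (Multiset.mem_cons_self f s)) (Multiset.prod_induction _ s
        (fun _ _ => Monic.mul) monic_one hs'), ih hs']

theorem rootPowerSum_X_sub_C {m : ℕ} (hm : 0 < m) (a : F) :
    rootPowerSum m (X - C a) = a ^ m := by
  have hrev : (X - C a).reverse = 1 - C a * X := by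
    rw [sub_eq_add_neg, ← C_neg, reverse_add_C]
    have h : (X : F[X]).reverse = 1 := by rw [reverse, natDegree_X, reflect_one_X]
    simp [h, sub_eq_add_neg]
  obtain ⟨m, rfl⟩ := Nat.exists_eq_succ_of_ne_zero hm.ne'
  have hinv : ((1 - C a * X : F[X]) : PowerSeries F)⁻¹ = PowerSeries.mk fun i => a ^ i := by
    symm
    rw [PowerSeries.eq_inv_iff_mul_eq_one (by simp)]
    ext i
    cases i with
    | zero => simp
    | succ i => simp [mul_sub, ← mul_assoc, PowerSeries.coeff_succ_mul_X, pow_succ]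
  rw [rootPowerSum, hrev, hinv, PowerSeries.derivative_coe, mul_assoc, map_neg,
    PowerSeries.coeff_succ_X_mul]
  simp [pow_succ']

theorem rootPowerSum_map {E : Type*} [Field E] (i : F →+* E) (m : ℕ) {f : F[X]} (hf : f.Monic) :
    rootPowerSum m (f.map i) = i (rootPowerSum m f) := by
  have hrev : ((f.map i).reverse : PowerSeries E) =
      PowerSeries.map i (f.reverse : PowerSeries F) := by
    ext k
    simp [reverse, natDegree_map, reflect_map]
  have hinv : (PowerSeries.map i (f.reverse : PowerSeries F))⁻¹ =
      PowerSeries.map i (f.reverse : PowerSeries F)⁻¹ := by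
    have h0 := constantCoeff_reverse hf
    symm
    rw [PowerSeries.eq_inv_iff_mul_eq_one, ← map_mul, PowerSeries.inv_mul_cancel, map_one]
    · simp [h0]
    · rw [← PowerSeries.coeff_zero_eq_constantCoeff_apply, PowerSeries.coeff_map,
        PowerSeries.coeff_zero_eq_constantCoeff_apply, h0, map_one]
      exact one_ne_zero
  have hder : PowerSeries.derivative E (PowerSeries.map i (f.reverse : PowerSeries F)) =
      PowerSeries.map i (PowerSeries.derivative F (f.reverse : PowerSeries F)) := by
    ext k
    simp [PowerSeries.coeff_derivative]
  rw [rootPowerSum, rootPowerSum, hrev, hinv, hder, ← PowerSeries.coeff_map]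
  simp only [map_neg, RingHom.map_mul, PowerSeries.map_X]

theorem rootPowerSum_eq_sum_aroots {E : Type*} [Field E] [Algebra F E] {m : ℕ} (hm : 0 < m)
    {f : F[X]} (hf : f.Monic) (hs : (f.map (algebraMap F E)).Splits) :
    algebraMap F E (rootPowerSum m f) = ((f.aroots E).map (· ^ m)).sum := by
  rw [← rootPowerSum_map _ _ hf]
  conv_lhs => rw [hs.eq_prod_roots_of_monic (hf.map _)]
  rw [rootPowerSum_multiset_prod, Multiset.map_map]
  · simp only [Function.comp_def, rootPowerSum_X_sub_C hm, aroots_def]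
  · intro g hg
    obtain ⟨a, _, rfl⟩ := Multiset.mem_map.1 hg
    exact monic_X_sub_C a

theorem rootPowerSum_one_left {f : F[X]} (hf : f.Monic) : rootPowerSum 1 f = -f.nextCoeff := by
  rw [rootPowerSum, map_neg, mul_assoc, PowerSeries.coeff_succ_X_mul,
    PowerSeries.coeff_zero_eq_constantCoeff_apply, map_mul, PowerSeries.constantCoeff_inv,
    constantCoeff_reverse hf, ← PowerSeries.coeff_zero_eq_constantCoeff_apply,
    PowerSeries.coeff_derivative, Polynomial.coeff_coe, coeff_one_reverse]
  simp

theorem rootPowerSum_add_C {f : F[X]} (hf : f.Monic) (hd : 0 < f.natDegree) (t : F) :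
    rootPowerSum f.natDegree (f + C t) = rootPowerSum f.natDegree f - f.natDegree * t := by
  have hm : (f + C t).Monic := hf.add_of_left
    (degree_C_le.trans_lt (natDegree_pos_iff_degree_pos.1 hd))
  obtain ⟨k, hk⟩ := Nat.exists_eq_succ_of_ne_zero hd.ne'
  have hrev : ((f + C t).reverse : PowerSeries F) =
      (f.reverse : PowerSeries F) + PowerSeries.C t * PowerSeries.X ^ f.natDegree := by
    rw [reverse_add_C]
    simp
  set A := (f.reverse : PowerSeries F) with hA
  set B := ((f + C t).reverse : PowerSeries F) with hB
  have hA1 : PowerSeries.constantCoeff A = 1 := constantCoeff_reverse hf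
  have hB1 : PowerSeries.constantCoeff B = 1 := constantCoeff_reverse hm
  have h1 := PowerSeries.mul_inv_cancel A (by simp [hA1])
  have h2 := PowerSeries.mul_inv_cancel B (by simp [hB1])
  have hD : PowerSeries.derivative F B = PowerSeries.derivative F A +
      PowerSeries.C (f.natDegree * t) * PowerSeries.X ^ k := by
    rw [hrev, map_add, Derivation.leibniz, PowerSeries.derivative_C, PowerSeries.derivative_pow,
      PowerSeries.derivative_X, hk]
    simp
    ring
  have key : -(PowerSeries.X * PowerSeries.derivative F B * B⁻¹) =
      -(PowerSeries.X * PowerSeries.derivative F A * A⁻¹) -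
        PowerSeries.C (f.natDegree * t) * (PowerSeries.X ^ (k + 1) * B⁻¹) +
        PowerSeries.C t * (PowerSeries.X ^ (k + 1) * (PowerSeries.X *
          (PowerSeries.derivative F A * A⁻¹ * B⁻¹))) := by
    have h3 : A⁻¹ - B⁻¹ = PowerSeries.C t * PowerSeries.X ^ (k + 1) * (A⁻¹ * B⁻¹) := by
      rw [hk, Nat.succ_eq_add_one] at hrev
      linear_combination (A⁻¹ * B⁻¹) * hrev + B⁻¹ * h1 - A⁻¹ * h2
    rw [hD]
    linear_combination PowerSeries.X * PowerSeries.derivative F A * h3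
  rw [rootPowerSum, ← hB, key, rootPowerSum, ← hA, map_add, map_sub, PowerSeries.coeff_C_mul,
    PowerSeries.coeff_C_mul, hk, PowerSeries.coeff_X_pow_mul', PowerSeries.coeff_X_pow_mul']
  simp [hB1]

open IntermediateField in
theorem finrank_adjoin_simple_eq {K : Type*} [Field K] [Algebra F K] [FiniteDimensional F K]
    (x : K) : Module.finrank F⟮x⟯ K = Module.finrank F K / (minpoly F x).natDegree := by
  rw [← adjoin.finrank (.of_finite F x), ← Module.finrank_mul_finrank F F⟮x⟯ K,
    Nat.mul_div_cancel_left _ Module.finrank_pos]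

open IntermediateField in
theorem trace_pow_eq {K : Type*} [Field K] [Algebra F K] [FiniteDimensional F K]
    [Algebra.IsSeparable F K] {m : ℕ} (hm : 0 < m) (x : K) :
    Algebra.trace F K (x ^ m) = rootPowerSum m (minpolyPow F x) := by
  have hi : IsIntegral F x := .of_finite F x
  have hsep : Algebra.IsSeparable F F⟮x⟯ :=
    Algebra.isSeparable_tower_bot_of_isSeparable F F⟮x⟯ K
  have h1 : Algebra.trace F K (x ^ m) = Module.finrank F⟮x⟯ K •
      Algebra.trace F F⟮x⟯ (AdjoinSimple.gen F x ^ m) := by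
    rw [← Algebra.trace_trace (S := F⟮x⟯)]
    have hx : x ^ m = algebraMap F⟮x⟯ K (AdjoinSimple.gen F x ^ m) := by
      rw [map_pow, AdjoinSimple.algebraMap_gen]
    rw [hx, Algebra.trace_algebraMap, LinearMap.map_smul_of_tower]
  have h2 : Algebra.trace F F⟮x⟯ (AdjoinSimple.gen F x ^ m) =
      rootPowerSum m (minpoly F x) := by
    apply (algebraMap F (AlgebraicClosure F)).injective
    have hnd : ((minpoly F x).aroots (AlgebraicClosure F)).Nodup :=
      nodup_aroots_iff_of_splits (minpoly.ne_zero hi) (IsAlgClosed.splits _) |>.2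
        (Algebra.IsSeparable.isSeparable F x)
    rw [trace_eq_sum_embeddings, rootPowerSum_eq_sum_aroots hm (minpoly.monic hi)
      (IsAlgClosed.splits _),
      ← (algHomAdjoinIntegralEquiv F hi).symm.sum_comp]
    simp only [map_pow, algHomAdjoinIntegralEquiv_symm_apply_gen]
    rw [Finset.sum_mem_multiset _ _ (fun a : AlgebraicClosure F => a ^ m) fun _ => rfl,
      Finset.sum_eq_multiset_sum, Multiset.toFinset_val, Multiset.dedup_eq_self.2 hnd]
  rw [h1, h2, nsmul_eq_mul, minpolyPow, rootPowerSum_pow m (minpoly.monic hi),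
    finrank_adjoin_simple_eq]

theorem norm_eq_coeff_zero_minpolyPow {K : Type*} [Field K] [Algebra F K] [FiniteDimensional F K]
    (x : K) :
    Algebra.norm F x = (-1) ^ (minpolyPow F x).natDegree * (minpolyPow F x).coeff 0 := by
  have hi : IsIntegral F x := .of_finite F x
  have h := Algebra.PowerBasis.norm_gen_eq_coeff_zero_minpoly
    (IntermediateField.adjoin.powerBasis hi)
  rw [IntermediateField.adjoin.powerBasis_gen, IntermediateField.minpoly_gen,
    IntermediateField.adjoin.powerBasis_dim] at h
  rw [Algebra.norm_eq_norm_adjoin, h, finrank_adjoin_simple_eq, minpolyPow, natDegree_pow,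
    mul_pow, coeff_zero_eq_eval_zero, coeff_zero_eq_eval_zero, eval_pow, ← pow_mul, mul_comm]
  ring

end RootPowerSum

section PowerSeries

variable {R : Type*} [Field R]

theorem X_mul_derivative_prod {ι : Type*} (s : Finset ι) (A L : ι → PowerSeries R)
    (h : ∀ i ∈ s, PowerSeries.X * PowerSeries.derivative R (L i) = A i * L i) :
    PowerSeries.X * PowerSeries.derivative R (∏ i ∈ s, L i) = (∑ i ∈ s, A i) * ∏ i ∈ s, L i := by
  induction s using Finset.induction_on with
  | empty => simp
  | insert i s hi ih =>
    have h1 := ih fun j hj => h j (Finset.mem_insert_of_mem hj)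
    have h2 := h i (Finset.mem_insert_self i s)
    rw [Finset.prod_insert hi, Finset.sum_insert hi, Derivation.leibniz, smul_eq_mul, smul_eq_mul]
    linear_combination L i * h1 + (∏ j ∈ s, L j) * h2

theorem eq_of_X_mul_derivative_eq [CharZero R] {A L M : PowerSeries R}
    (hL : PowerSeries.X * PowerSeries.derivative R L = A * L)
    (hM : PowerSeries.X * PowerSeries.derivative R M = A * M)
    (hL0 : PowerSeries.constantCoeff L = 1) (hM0 : PowerSeries.constantCoeff M = 1) : L = M := by
  have hinv := PowerSeries.mul_inv_cancel M (by simp [hM0])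
  have h : L * M⁻¹ = 1 := by
    refine PowerSeries.derivative.ext ?_ (by simp [hL0, hM0])
    rw [PowerSeries.derivative_one, Derivation.leibniz, smul_eq_mul, smul_eq_mul,
      PowerSeries.derivative_inv']
    apply mul_left_cancel₀ (PowerSeries.X_ne_zero (R := R))
    linear_combination M⁻¹ * hL - L * M⁻¹ ^ 2 * hM - A * L * M⁻¹ * hinv
  calc L = L * M⁻¹ * M := by linear_combination -L * hinv
    _ = M := by rw [h, one_mul]

end PowerSeries

/-- The multiplicative function on monic polynomials sending `f` with roots `aᵢ` to
`μ (∏ aᵢ) * ψ (∑ aᵢ ^ m)`. -/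
noncomputable def polyChar {F : Type*} [Field F] (μ : MulChar F ℂ) (ψ : AddChar F ℂ) (m : ℕ)
    (f : F[X]) : ℂ :=
  μ ((-1) ^ f.natDegree * f.coeff 0) * ψ (rootPowerSum m f)

section PolyChar

variable {F : Type*} [Field F] (μ : MulChar F ℂ) (ψ : AddChar F ℂ) (m : ℕ)

theorem polyChar_mul {f g : F[X]} (hf : f.Monic) (hg : g.Monic) :
    polyChar μ ψ m (f * g) = polyChar μ ψ m f * polyChar μ ψ m g := by
  simp only [polyChar]
  rw [rootPowerSum_mul m hf hg, AddChar.map_add_eq_mul, hf.natDegree_mul hg, mul_coeff_zero,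
    pow_add, mul_mul_mul_comm, map_mul, mul_mul_mul_comm]

theorem polyChar_one : polyChar μ ψ m 1 = 1 := by
  simp [polyChar, rootPowerSum_one]

theorem polyChar_minpolyPow {m : ℕ} (hm : 0 < m) {K : Type*} [Field K] [Algebra F K]
    [FiniteDimensional F K] [Algebra.IsSeparable F K] (x : K) :
    polyChar μ ψ m (minpolyPow F x) = μ (Algebra.norm F x) * ψ (Algebra.trace F K (x ^ m)) := by
  rw [polyChar, trace_pow_eq hm, norm_eq_coeff_zero_minpolyPow]

variable [Fintype F]

/-- The L-series of `polyChar μ ψ m`. -/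
noncomputable def polyCharSeries : PowerSeries ℂ :=
  PowerSeries.mk fun k => ∑ f ∈ monicsOfDegree F k, polyChar μ ψ m f

theorem monicsOfDegree_zero : monicsOfDegree F 0 = {1} := by
  ext f
  rw [mem_monicsOfDegree, Finset.mem_singleton]
  exact ⟨fun h => h.1.natDegree_eq_zero.1 h.2, by rintro rfl; simp⟩

theorem constantCoeff_polyCharSeries :
    PowerSeries.constantCoeff (polyCharSeries μ ψ m) = 1 := by
  rw [← PowerSeries.coeff_zero_eq_constantCoeff_apply, polyCharSeries, PowerSeries.coeff_mk,
    monicsOfDegree_zero, Finset.sum_singleton, polyChar_one]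

/-- The generating series of the character sums of `μ ∘ norm` and `ψ ∘ trace (· ^ m)` over a family
of finite extensions. -/
noncomputable def charSumSeries (K : ℕ → Type*) [∀ j, Field (K j)] [∀ j, Algebra F (K j)]
    [∀ j, Fintype (K j)] : PowerSeries ℂ :=
  PowerSeries.mk fun j => if j = 0 then 0 else
    ∑ x : K j, μ (Algebra.norm F x) * ψ (Algebra.trace F (K j) (x ^ m))

theorem X_mul_derivative_polyCharSeries {m : ℕ} (hm : 0 < m) (K : ℕ → Type*) [∀ j, Field (K j)]
    [∀ j, Algebra F (K j)] [∀ j, FiniteDimensional F (K j)] [∀ j, Fintype (K j)]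
    (hK : ∀ j, 1 ≤ j → Module.finrank F (K j) = j) :
    PowerSeries.X * PowerSeries.derivative ℂ (polyCharSeries μ ψ m) =
      charSumSeries μ ψ m K * polyCharSeries μ ψ m := by
  ext k
  have h := natCast_mul_sum_monicsOfDegree K hK (polyChar μ ψ m)
    (fun f g hf hg => polyChar_mul μ ψ m hf hg) k
  trans (k : ℂ) * ∑ f ∈ monicsOfDegree F k, polyChar μ ψ m f
  · cases k with
    | zero => simp
    | succ k =>
      rw [PowerSeries.coeff_succ_X_mul, PowerSeries.coeff_derivative, polyCharSeries,
        PowerSeries.coeff_mk]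
      push_cast
      ring
  · rw [h, PowerSeries.coeff_mul, Finset.Nat.sum_antidiagonal_eq_sum_range_succ_mk,
      Finset.sum_range_succ']
    simp only [charSumSeries, polyCharSeries, PowerSeries.coeff_mk, polyChar_minpolyPow μ ψ hm]
    rw [if_pos trivial, zero_mul, add_zero]
    symm
    refine Finset.sum_nbij' (· + 1) (· - 1) ?_ ?_ ?_ ?_ ?_
    · intro i hi
      rw [Finset.mem_range] at hi
      exact Finset.mem_Icc.2 (by omega)
    · intro j hj
      rw [Finset.mem_Icc] at hj
      exact Finset.mem_range.2 (by omega)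
    · intro i _
      exact Nat.add_sub_cancel i 1
    · intro j hj
      rw [Finset.mem_Icc] at hj
      exact Nat.sub_add_cancel hj.1
    · intro i _
      rw [if_neg i.succ_ne_zero]

theorem polyCharSeries_one {ψ : AddChar F ℂ} (hψ : ψ ≠ 1) :
    polyCharSeries μ ψ 1 = 1 + PowerSeries.C (gaussSum μ ψ) * PowerSeries.X := by
  ext k
  rw [polyCharSeries, PowerSeries.coeff_mk]
  match k with
  | 0 =>
    rw [monicsOfDegree_zero, Finset.sum_singleton, polyChar_one]
    simp
  | 1 =>
    trans gaussSum μ ψ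
    · rw [gaussSum]
      refine Finset.sum_nbij' (fun f => -f.coeff 0) (fun a => X - C a) ?_ ?_ ?_ ?_ ?_
      · simp
      · intro a _
        exact mem_monicsOfDegree.2 ⟨monic_X_sub_C a, natDegree_X_sub_C a⟩
      · intro f hf
        obtain ⟨hf, hd⟩ := mem_monicsOfDegree.1 hf
        rw [hf.eq_X_add_C hd]
        simp
      · simp
      · intro f hf
        obtain ⟨hf, hd⟩ := mem_monicsOfDegree.1 hf
        rw [polyChar, hd, rootPowerSum_one_left hf, nextCoeff_of_natDegree_pos (by omega), hd]
        simp
    · simp [PowerSeries.coeff_one]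
  | k + 2 =>
    trans 0
    · obtain ⟨t, ht⟩ := AddChar.ne_one_iff.1 hψ
      have hdeg : ∀ f : F[X], f ∈ monicsOfDegree F (k + 2) → ∀ s : F,
          f + C s * X ^ (k + 1) ∈ monicsOfDegree F (k + 2) := by
        intro f hf s
        obtain ⟨hf, hd⟩ := mem_monicsOfDegree.1 hf
        have hlt : (C s * X ^ (k + 1)).degree < f.degree := by
          rw [degree_eq_natDegree hf.ne_zero, hd]
          exact (degree_C_mul_X_pow_le _ _).trans_lt (by exact_mod_cast Nat.lt_succ_self (k + 1))
        exact mem_monicsOfDegree.2 ⟨hf.add_of_left hlt, by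
          rw [← hd]; exact natDegree_add_eq_left_of_degree_lt hlt⟩
      have h : ∑ f ∈ monicsOfDegree F (k + 2), polyChar μ ψ 1 f =
          ψ t * ∑ f ∈ monicsOfDegree F (k + 2), polyChar μ ψ 1 f := by
        rw [Finset.mul_sum]
        refine Finset.sum_nbij' (fun f => f + C t * X ^ (k + 1))
          (fun f => f + C (-t) * X ^ (k + 1)) (fun f hf => hdeg f hf t)
          (fun f hf => hdeg f hf (-t)) ?_ ?_ ?_
        · intro f _
          simp
        · intro f _
          simp
        · intro f hf
          obtain ⟨hf1, hd1⟩ := mem_monicsOfDegree.1 hf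
          obtain ⟨hf2, hd2⟩ := mem_monicsOfDegree.1 (hdeg f hf t)
          have h0 : (f + C t * X ^ (k + 1)).coeff 0 = f.coeff 0 := by simp
          have h1 : rootPowerSum 1 f = t + rootPowerSum 1 (f + C t * X ^ (k + 1)) := by
            rw [rootPowerSum_one_left hf1, rootPowerSum_one_left hf2,
              nextCoeff_of_natDegree_pos (by omega), nextCoeff_of_natDegree_pos (by omega),
              hd1, hd2]
            simp
          rw [polyChar, polyChar, hd1, hd2, h0, h1, AddChar.map_add_eq_mul]
          ring
      have h2 : (1 - ψ t) * ∑ f ∈ monicsOfDegree F (k + 2), polyChar μ ψ 1 f = 0 := by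
        linear_combination h
      exact (mul_eq_zero.1 h2).resolve_left (sub_ne_zero.2 (Ne.symm ht))
    · rw [map_add, PowerSeries.coeff_C_mul, PowerSeries.coeff_X, PowerSeries.coeff_one]
      simp

theorem coeff_polyCharSeries_self {n : ℕ} (hn : 0 < n) :
    PowerSeries.coeff n (polyCharSeries μ ψ n) =
      (∑ g ∈ monicsOfDegree F n with g.coeff 0 = 0, ψ (rootPowerSum n g)) *
        ∑ t : F, μ ((-1) ^ n * t) * ψ (-(n * t)) := by
  rw [polyCharSeries, PowerSeries.coeff_mk, Finset.sum_mul_sum, ← Finset.sum_product']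
  have hdeg : ∀ f : F[X], f ∈ monicsOfDegree F n → ∀ s : F, f + C s ∈ monicsOfDegree F n := by
    intro f hf s
    obtain ⟨hf, hd⟩ := mem_monicsOfDegree.1 hf
    exact mem_monicsOfDegree.2 ⟨hf.add_of_left (degree_C_le.trans_lt
      (natDegree_pos_iff_degree_pos.1 (by omega))), by rw [natDegree_add_C, hd]⟩
  refine Finset.sum_nbij' (fun f => (f + C (-f.coeff 0), f.coeff 0)) (fun q => q.1 + C q.2)
    ?_ ?_ ?_ ?_ ?_
  · intro f hf
    simp only [Finset.mem_product, Finset.mem_filter, Finset.mem_univ, and_true]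
    exact ⟨hdeg f hf _, by simp⟩
  · intro q hq
    simp only [Finset.mem_product, Finset.mem_filter, Finset.mem_univ, and_true] at hq
    exact hdeg _ hq.1 _
  · intro f _
    simp
  · rintro ⟨g, t⟩ hq
    simp only [Finset.mem_product, Finset.mem_filter, Finset.mem_univ, and_true] at hq
    simp [hq.2]
  · intro f hf
    obtain ⟨hm, rfl⟩ := mem_monicsOfDegree.1 hf
    have h := rootPowerSum_add_C hm hn (-f.coeff 0)
    rw [polyChar, h, mul_left_comm, ← AddChar.map_add_eq_mul]
    congr 2
    ring

end PolyChar

section PowerResidues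

theorem card_filter_pow_eq_one {G : Type*} [CommGroup G] [IsCyclic G] [Fintype G] {n : ℕ}
    [DecidablePred fun g : G => g ^ n = 1] (hn : n ∣ Nat.card G) :
    (Finset.univ.filter fun g : G => g ^ n = 1).card = n := by
  have h := IsCyclic.card_powMonoidHom_ker (G := G) n
  rw [Nat.gcd_eq_right hn] at h
  rw [← Fintype.card_subtype, ← Nat.card_eq_fintype_card]
  exact h

variable {F : Type*} [Field F] [Fintype F]

theorem card_filter_mulChar_pow_eq_one [Fintype (MulChar F ℂ)] {n : ℕ} (hn : n ∣ Nat.card Fˣ) :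
    (Finset.univ.filter fun χ : MulChar F ℂ => χ ^ n = 1).card = n := by
  obtain ⟨e⟩ := MulChar.mulEquiv_units F ℂ
  have : IsCyclic (MulChar F ℂ) := e.isCyclic.2 inferInstance
  exact card_filter_pow_eq_one (hn.trans (Nat.card_congr e.toEquiv).symm.dvd)

variable {K : Type*} [Field K] [Fintype K] [Algebra F K]

theorem exists_mulChar_norm_ne_one {n : ℕ} (hn : n ∣ Nat.card Fˣ) {u : Kˣ}
    (hu : ∀ v : Kˣ, v ^ n ≠ u) : ∃ χ : MulChar F ℂ, χ ^ n = 1 ∧ χ (Algebra.norm F (u : K)) ≠ 1 := by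
  have hn0 : n ≠ 0 := by
    rintro rfl
    exact Nat.card_pos.ne' (zero_dvd_iff.1 hn)
  obtain ⟨γ, hγ⟩ := IsCyclic.exists_generator (α := Kˣ)
  have hδ : ∀ a : Fˣ, a ∈ Subgroup.zpowers (Units.map (Algebra.norm F (S := K)) γ) := by
    intro a
    obtain ⟨b, rfl⟩ := FiniteField.unitsMap_norm_surjective F K a
    obtain ⟨k, rfl⟩ := Subgroup.mem_zpowers_iff.1 (hγ b)
    exact ⟨k, (map_zpow _ _ _).symm⟩
  have hζ := Complex.isPrimitiveRoot_exp n hn0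
  obtain ⟨ζ, hζu⟩ := hζ.isUnit hn0
  rw [← hζu] at hζ
  have hζ' : IsPrimitiveRoot ζ n := IsPrimitiveRoot.coe_units_iff.1 hζ
  have hmem : ζ ∈ rootsOfUnity (Fintype.card Fˣ) ℂ := by
    rw [mem_rootsOfUnity, ← Nat.card_eq_fintype_card]
    exact (hζ'.pow_eq_one_iff_dvd _).2 hn
  have hspec := MulChar.ofRootOfUnity_spec hmem hδ
  refine ⟨MulChar.ofRootOfUnity hmem hδ, ?_, ?_⟩
  · rw [MulChar.eq_iff hδ, MulChar.pow_apply_coe, hspec, MulChar.one_apply_coe, hζ.pow_eq_one]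
  · obtain ⟨k, rfl⟩ := Submonoid.mem_powers_iff _ _ |>.1 (mem_powers_iff_mem_zpowers.2 (hγ u))
    rw [Units.coe_map] at hspec
    rw [Units.val_pow_eq_pow_val, map_pow, map_pow]
    erw [hspec]
    intro h
    obtain ⟨l, rfl⟩ := (hζ.pow_eq_one_iff_dvd k).1 h
    exact hu (γ ^ l) (by rw [← pow_mul, mul_comm])

theorem sum_mulChar_norm [Fintype (MulChar F ℂ)] {n : ℕ} (hn : n ∣ Nat.card Fˣ) {x : K}
    (hx : x ≠ 0) :
    ∑ χ : MulChar F ℂ with χ ^ n = 1, χ (Algebra.norm F x) =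
      ((Finset.univ.filter fun y : K => y ^ n = x).card : ℂ) := by
  have hn0 : n ≠ 0 := by
    rintro rfl
    exact Nat.card_pos.ne' (zero_dvd_iff.1 hn)
  by_cases h : ∃ y : K, y ^ n = x
  · obtain ⟨y, rfl⟩ := h
    have hy : y ≠ 0 := fun h => hx (by rw [h, zero_pow hn0])
    have hcard : (Finset.univ.filter fun z : K => z ^ n = y ^ n).card = n := by
      have hK : n ∣ Nat.card Kˣ := hn.trans
        (Subgroup.card_dvd_of_surjective _ (FiniteField.unitsMap_norm_surjective F K))
      refine Eq.trans (Eq.symm ?_) (card_filter_pow_eq_one hK)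
      refine Finset.card_bij (fun u _ => (u : K) * y) ?_ ?_ ?_
      · intro u hu
        have h1 : u ^ n = 1 := (Finset.mem_filter.1 hu).2
        refine Finset.mem_filter.2 ⟨Finset.mem_univ _, ?_⟩
        rw [mul_pow, ← Units.val_pow_eq_pow_val, h1, Units.val_one, one_mul]
      · intro u _ v _ huv
        exact Units.ext (mul_right_cancel₀ hy huv)
      · intro z hz
        have h1 : z ^ n = y ^ n := (Finset.mem_filter.1 hz).2
        have hz0 : z ≠ 0 := fun h => pow_ne_zero n hy (by rw [← h1, h, zero_pow hn0])
        refine ⟨Units.mk0 (z / y) (div_ne_zero hz0 hy), ?_, ?_⟩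
        · refine Finset.mem_filter.2 ⟨Finset.mem_univ _, Units.ext ?_⟩
          rw [Units.val_pow_eq_pow_val, Units.val_mk0, div_pow, h1, div_self (pow_ne_zero n hy),
            Units.val_one]
        · rw [Units.val_mk0, div_mul_cancel₀ _ hy]
    rw [hcard, Finset.sum_congr rfl (g := fun _ => (1 : ℂ))]
    · rw [Finset.sum_const, card_filter_mulChar_pow_eq_one hn, nsmul_one]
    · intro χ hχ
      have h1 : χ ^ n = 1 := (Finset.mem_filter.1 hχ).2
      rw [map_pow, map_pow, ← MulChar.pow_apply' χ hn0, h1,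
        MulChar.one_apply (isUnit_iff_ne_zero.2 (Algebra.norm_ne_zero_iff.2 hy))]
  · rw [Finset.filter_eq_empty_iff.2 fun y _ hy => h ⟨y, hy⟩, Finset.card_empty, Nat.cast_zero]
    obtain ⟨χ₀, h1, h2⟩ := exists_mulChar_norm_ne_one (F := F) (u := Units.mk0 x hx) hn
      fun v hv => h ⟨v, by rw [← Units.val_pow_eq_pow_val, hv, Units.val_mk0]⟩
    rw [Units.val_mk0] at h2
    have h3 : ∑ χ : MulChar F ℂ with χ ^ n = 1, χ (Algebra.norm F x) =
        χ₀ (Algebra.norm F x) * ∑ χ : MulChar F ℂ with χ ^ n = 1, χ (Algebra.norm F x) := by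
      rw [Finset.mul_sum]
      symm
      refine Finset.sum_nbij' (χ₀ * ·) (χ₀⁻¹ * ·) ?_ ?_ ?_ ?_ ?_
      · intro χ hχ
        simp only [Finset.mem_filter, Finset.mem_univ, true_and] at hχ ⊢
        rw [mul_pow, h1, hχ, one_mul]
      · intro χ hχ
        simp only [Finset.mem_filter, Finset.mem_univ, true_and] at hχ ⊢
        rw [mul_pow, inv_pow, h1, hχ, inv_one, one_mul]
      · intro χ _
        exact inv_mul_cancel_left _ _
      · intro χ _
        exact mul_inv_cancel_left _ _
      · intro χ _
        exact (MulChar.mul_apply _ _ _).symm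
    have h4 : (1 - χ₀ (Algebra.norm F x)) *
        ∑ χ : MulChar F ℂ with χ ^ n = 1, χ (Algebra.norm F x) = 0 := by
      linear_combination h3
    exact (mul_eq_zero.1 h4).resolve_left (sub_ne_zero.2 (Ne.symm h2))

theorem sum_mulChar_pow_norm_mul_addChar [Fintype (MulChar F ℂ)] {n : ℕ} (hn : n ∣ Nat.card Fˣ)
    (κ : MulChar F ℂ) (ψ : AddChar F ℂ) :
    ∑ y : K, (κ ^ n) (Algebra.norm F y) * ψ (Algebra.trace F K (y ^ n)) =
      ∑ χ : MulChar F ℂ with χ ^ n = 1,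
        ∑ x : K, (χ * κ) (Algebra.norm F x) * ψ (Algebra.trace F K (x ^ 1)) := by
  have hn0 : n ≠ 0 := by
    rintro rfl
    exact Nat.card_pos.ne' (zero_dvd_iff.1 hn)
  have hfib := Finset.sum_fiberwise (Finset.univ : Finset K) (fun y : K => y ^ n)
    (fun y : K => (κ ^ n) (Algebra.norm F y) * ψ (Algebra.trace F K (y ^ n)))
  rw [← hfib, Finset.sum_comm]
  refine Finset.sum_congr rfl fun x _ => ?_
  rw [Finset.sum_congr rfl (g := fun _ => κ (Algebra.norm F x) * ψ (Algebra.trace F K x))]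
  · simp only [MulChar.mul_apply, pow_one, mul_assoc]
    rw [Finset.sum_const, nsmul_eq_mul]
    by_cases hx : x = 0
    · have h0 : κ (Algebra.norm F x) = 0 := by
        rw [hx, Algebra.norm_zero, MulChar.map_zero]
      simp only [h0, zero_mul, mul_zero, Finset.sum_const_zero]
    · rw [← Finset.sum_mul, sum_mulChar_norm hn hx]
  · intro y hy
    have h1 : y ^ n = x := (Finset.mem_filter.1 hy).2
    rw [MulChar.pow_apply' κ hn0, ← map_pow κ, ← map_pow, h1]

theorem charSumSeries_pow [Fintype (MulChar F ℂ)] {n : ℕ} (hn : n ∣ Nat.card Fˣ)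
    (κ : MulChar F ℂ) (ψ : AddChar F ℂ) (K : ℕ → Type*) [∀ j, Field (K j)] [∀ j, Algebra F (K j)]
    [∀ j, Fintype (K j)] :
    charSumSeries (κ ^ n) ψ n K =
      ∑ χ : MulChar F ℂ with χ ^ n = 1, charSumSeries (χ * κ) ψ 1 K := by
  ext j
  simp only [map_sum, charSumSeries, PowerSeries.coeff_mk]
  split_ifs
  · rw [Finset.sum_const_zero]
  · exact sum_mulChar_pow_norm_mul_addChar hn κ ψ

end PowerResidues

theorem coeff_card_prod_one_add_C_mul_X {R ι : Type*} [CommRing R] (s : Finset ι) (a : ι → R) :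
    PowerSeries.coeff s.card (∏ i ∈ s, (1 + PowerSeries.C (a i) * PowerSeries.X)) =
      ∏ i ∈ s, a i := by
  have h : (∏ i ∈ s, (1 + PowerSeries.C (a i) * PowerSeries.X) : PowerSeries R) =
      ((∏ i ∈ s, (1 + C (a i) * X) : R[X]) : PowerSeries R) := by
    rw [← Polynomial.coeToPowerSeries.ringHom_apply, map_prod]
    simp
  rw [h, Polynomial.coeff_coe]
  have h2 := Polynomial.coeff_prod_of_natDegree_le (s := s) (fun i => 1 + C (a i) * X) 1
    (fun i _ => by compute_degree)
  rw [mul_one] at h2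
  rw [h2]
  simp [coeff_one]

theorem sum_mulChar_pow_mul_addChar {F : Type*} [Field F] [Fintype F] {n : ℕ} (hn : (n : F) ≠ 0)
    (κ : MulChar F ℂ) (ψ : AddChar F ℂ) :
    ∑ t : F, (κ ^ n) ((-1) ^ n * t) * ψ (-(n * t)) = gaussSum (κ ^ n) ψ * κ ((n : F)⁻¹ ^ n) := by
  have hn0 : n ≠ 0 := by
    rintro rfl
    simp at hn
  rw [gaussSum, Finset.sum_mul]
  refine Fintype.sum_equiv (Equiv.mulLeft₀ (-(n : F)) (neg_ne_zero.2 hn)) _ _ fun t => ?_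
  have hsign : ((-1 : F) ^ n) ^ n = (-1) ^ n := by
    rcases Nat.even_or_odd n with h | h
    · rw [h.neg_one_pow, one_pow]
    · rw [h.neg_one_pow, h.neg_one_pow]
  simp only [Equiv.mulLeft₀_apply, neg_mul]
  rw [mul_right_comm, MulChar.pow_apply' κ hn0, MulChar.pow_apply' κ hn0, ← map_pow κ, ← map_pow κ,
    ← map_mul κ]
  congr 2
  rw [mul_pow, hsign, neg_pow (_ * t), mul_pow, inv_pow]
  field_simp

section ProdGaussSum

variable {F : Type*} [Field F] [Fintype F] [Fintype (MulChar F ℂ)] {n : ℕ} {ψ : AddChar F ℂ}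

theorem polyCharSeries_pow (hn : n ∣ Nat.card Fˣ) (hψ : ψ ≠ 1) (κ : MulChar F ℂ)
    (K : ℕ → Type*) [∀ j, Field (K j)] [∀ j, Algebra F (K j)] [∀ j, FiniteDimensional F (K j)]
    [∀ j, Fintype (K j)]
    (hK : ∀ j, 1 ≤ j → Module.finrank F (K j) = j) :
    polyCharSeries (κ ^ n) ψ n = ∏ χ : MulChar F ℂ with χ ^ n = 1,
      (1 + PowerSeries.C (gaussSum (χ * κ) ψ) * PowerSeries.X) := by
  have hn0 : 0 < n := Nat.pos_of_dvd_of_pos hn Nat.card_pos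
  refine eq_of_X_mul_derivative_eq (X_mul_derivative_polyCharSeries _ _ hn0 K hK) ?_
    (constantCoeff_polyCharSeries _ _ _) (by simp [map_prod])
  rw [charSumSeries_pow hn]
  refine X_mul_derivative_prod _ _ _ fun χ _ => ?_
  rw [← polyCharSeries_one _ hψ]
  exact X_mul_derivative_polyCharSeries _ _ one_pos K hK

theorem prod_gaussSum_mul (hn : n ∣ Nat.card Fˣ) (hnF : (n : F) ≠ 0) (hψ : ψ ≠ 1)
    (K : ℕ → Type*) [∀ j, Field (K j)] [∀ j, Algebra F (K j)] [∀ j, FiniteDimensional F (K j)]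
    [∀ j, Fintype (K j)]
    (hK : ∀ j, 1 ≤ j → Module.finrank F (K j) = j) (κ : MulChar F ℂ) :
    ∏ χ : MulChar F ℂ with χ ^ n = 1, gaussSum (χ * κ) ψ =
      -gaussSum (κ ^ n) ψ * κ ((n : F)⁻¹ ^ n) *
        ∏ χ : MulChar F ℂ with χ ^ n = 1, gaussSum χ ψ := by
  have hn0 : 0 < n := Nat.pos_of_dvd_of_pos hn Nat.card_pos
  have key : ∀ κ : MulChar F ℂ, ∏ χ : MulChar F ℂ with χ ^ n = 1, gaussSum (χ * κ) ψ =
      (∑ g ∈ monicsOfDegree F n with g.coeff 0 = 0, ψ (rootPowerSum n g)) *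
        (gaussSum (κ ^ n) ψ * κ ((n : F)⁻¹ ^ n)) := by
    intro κ
    rw [← coeff_card_prod_one_add_C_mul_X, ← polyCharSeries_pow hn hψ κ K hK,
      card_filter_mulChar_pow_eq_one hn, coeff_polyCharSeries_self _ _ hn0,
      sum_mulChar_pow_mul_addChar hnF]
  have h1 := key 1
  simp only [mul_one, one_pow] at h1
  rw [gaussSum_one_left hψ, MulChar.one_apply ((isUnit_iff_ne_zero.2 (inv_ne_zero hnF)).pow n)] at h1
  rw [key κ, h1]
  ring

end ProdGaussSum

/-- **Davenport–Hasse relation.** Let `n` be a positive integer, `p` a prime with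
`p ≡ 1 (mod n)` and `p ∤ n`, and `ψ` a nontrivial additive character of `F_p` with
values in `ℂ`. Then for every multiplicative character `κ` of `F_p`,
`∏_{χ : χⁿ = ε} g(χκ) = -g(κⁿ)·κ(n⁻ⁿ)·∏_{χ : χⁿ = ε} g(χ)`, where both products run
over all multiplicative characters `χ` of `F_p` with `χⁿ` trivial. -/
theorem davenport_hasse (n : ℕ) (hn : 0 < n) (p : ℕ) [Fact p.Prime]
    (hpn : p ≡ 1 [MOD n]) (hpnd : ¬ (p ∣ n))
    (ψ : AddChar (ZMod p) ℂ) (hψ : ψ ≠ 1) (κ : MulChar (ZMod p) ℂ) :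
    letI : Fintype (MulChar (ZMod p) ℂ) := Fintype.ofFinite _
    ∏ χ ∈ Finset.univ.filter (fun χ : MulChar (ZMod p) ℂ => χ ^ n = 1),
        gaussSum (χ * κ) ψ =
      -gaussSum (κ ^ n) ψ * κ (((n : ZMod p))⁻¹ ^ n) *
        ∏ χ ∈ Finset.univ.filter (fun χ : MulChar (ZMod p) ℂ => χ ^ n = 1),
          gaussSum χ ψ := by
  let _ : Fintype (MulChar (ZMod p) ℂ) := Fintype.ofFinite _
  let _ : ∀ j, Fintype (GaloisField p j) := fun j => Fintype.ofFinite _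
  have hcard : n ∣ Nat.card (ZMod p)ˣ := by
    rw [Nat.card_eq_fintype_card, ZMod.card_units]
    exact (Nat.modEq_iff_dvd' (Fact.out : p.Prime).one_le).1 hpn.symm
  exact prod_gaussSum_mul hcard (by rwa [Ne, ZMod.natCast_eq_zero_iff]) hψ
    (fun j => GaloisField p j) (fun j hj => GaloisField.finrank p (by omega)) κ
end
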